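/- For a finite field F_q and integers d ≥ n ≥ 1, m ≥ 1, the number of m-tuples (f_1,...,f_m) of monic degree-d polynomials in F_q[z] having no common root in the algebraic closure of F_q of multiplicity ≥ n equals q^{dm} − q^{(d−n)m+1}. -/

import Mathlib

open Polynomial

def FreeT {F : Type} [Field F] {m : ℕ} (n : ℕ) (h : Fin m → F[X]) : Prop :=
  ∀ g : F[X], (∀ i, g ^ n ∣ h i) → IsUnit g

def TT (F : Type) [Field F] (d m : ℕ) : Set (Fin m → F[X]) :=
  {f | ∀ i, (f i).Monic ∧ (f i).natDegree = d}

def PP (F : Type) [Field F] (d n m : ℕ) : Set (F[X] × (Fin m → F[X])) :=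
  {p | p.1.Monic ∧ (∀ i, (p.2 i).Monic ∧ n * p.1.natDegree + (p.2 i).natDegree = d) ∧ FreeT n p.2}

noncomputable def prodMap {F : Type} [Field F] {m : ℕ} (n : ℕ) (p : F[X] × (Fin m → F[X])) : Fin m → F[X] :=
  fun i => p.1 ^ n * p.2 i

theorem minpoly_pow_dvd {F : Type} [Field F] [Fintype F] (α : AlgebraicClosure F) (n : ℕ) :
    ∀ f : F[X], (X - C α) ^ n ∣ f.map (algebraMap F (AlgebraicClosure F)) →
      (minpoly F α) ^ n ∣ f := by
  have hint : IsIntegral F α := Algebra.IsIntegral.isIntegral α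
  have hirr := minpoly.irreducible hint
  have hsep : (minpoly F α).Separable := PerfectField.separable_of_irreducible hirr
  induction n with
  | zero => intro f _; simp
  | succ n ih =>
    intro f hf
    have h1 : minpoly F α ∣ f := by
      apply minpoly.dvd
      have : (X - C α) ∣ f.map (algebraMap F (AlgebraicClosure F)) :=
        (dvd_pow_self _ (Nat.succ_ne_zero n)).trans hf
      rw [dvd_iff_isRoot, IsRoot.def, eval_map_algebraMap] at this
      exact this
    obtain ⟨f1, rfl⟩ := h1
    have hr : (X - C α) ∣ (minpoly F α).map (algebraMap F (AlgebraicClosure F)) := by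
      rw [dvd_iff_isRoot, IsRoot.def, eval_map_algebraMap]
      exact minpoly.aeval F α
    obtain ⟨r, hr⟩ := hr
    have hsep2 := hsep.map (f := algebraMap F (AlgebraicClosure F))
    rw [hr] at hsep2
    have hcop : IsCoprime (X - C α) r := hsep2.isCoprime
    rw [Polynomial.map_mul, hr, pow_succ', mul_assoc] at hf
    have hf2 := (mul_dvd_mul_iff_left (X_sub_C_ne_zero α)).1 hf
    have hf3 := (hcop.pow_left).dvd_of_dvd_mul_left hf2
    rw [pow_succ']
    exact mul_dvd_mul_left _ (ih f1 hf3)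

theorem free_iff {F : Type} [Field F] [Fintype F] {m n : ℕ} (hm : 1 ≤ m) (f : Fin m → F[X])
    (hf : ∀ i, (f i).Monic) (hn : 1 ≤ n) :
    (¬ ∃ α : AlgebraicClosure F, ∀ i,
        (X - C α) ^ n ∣ (f i).map (algebraMap F (AlgebraicClosure F))) ↔ FreeT n f := by
  constructor
  · intro h g hg
    by_contra hu
    apply h
    have hg0 : g ≠ 0 := by
      rintro rfl
      have := hg ⟨0, hm⟩
      rw [zero_pow (by omega), zero_dvd_iff] at this
      exact (hf _).ne_zero this
    have hdeg : g.degree ≠ 0 := fun h0 => hu (isUnit_iff_degree_eq_zero.2 h0)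
    obtain ⟨α, hα⟩ := IsAlgClosed.exists_aeval_eq_zero (AlgebraicClosure F) g hdeg
    refine ⟨α, fun i => ?_⟩
    have h1 : (X - C α) ∣ g.map (algebraMap F (AlgebraicClosure F)) := by
      rw [dvd_iff_isRoot, IsRoot.def, eval_map_algebraMap]
      exact hα
    refine (pow_dvd_pow_of_dvd h1 n).trans ?_
    rw [← Polynomial.map_pow]
    exact Polynomial.map_dvd _ (hg i)
  · rintro h ⟨α, hα⟩
    have hint : IsIntegral F α := Algebra.IsIntegral.isIntegral α
    exact (minpoly.irreducible hint).not_isUnit (h _ fun i => minpoly_pow_dvd α n _ (hα i))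

theorem inj_aux {F : Type} [Field F] {m n : ℕ} 
    (g g' : F[X]) (h h' : Fin m → F[X]) (hg : g.Monic) (hg' : g'.Monic)
    (hh' : FreeT n h') (e : ∀ i, g ^ n * h i = g' ^ n * h' i) : g ∣ g' := by
  classical
  obtain ⟨a, ha⟩ := EuclideanDomain.gcd_dvd_left g g'
  obtain ⟨b, hb⟩ := EuclideanDomain.gcd_dvd_right g g'
  set D := EuclideanDomain.gcd g g' with hD
  have hD0 : D ≠ 0 := by
    intro h0
    rw [h0, zero_mul] at ha
    exact hg.ne_zero ha
  have hcop : IsCoprime a b := by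
    refine ⟨EuclideanDomain.gcdA g g', EuclideanDomain.gcdB g g', ?_⟩
    have := EuclideanDomain.gcd_eq_gcd_ab g g'
    rw [← hD] at this
    apply mul_left_cancel₀ hD0
    calc _ = (D * a) * EuclideanDomain.gcdA g g' + (D * b) * EuclideanDomain.gcdB g g' := by ring
      _ = _ := by rw [← ha, ← hb, ← this, mul_one]
  have hu : IsUnit a := by
    apply hh'
    intro i
    have h1 := e i
    rw [ha, hb, mul_pow, mul_pow, mul_assoc, mul_assoc] at h1
    have h2 := mul_left_cancel₀ (pow_ne_zero n hD0) h1
    exact (hcop.pow (m := n) (n := n)).dvd_of_dvd_mul_left ⟨_, h2.symm⟩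
  rw [ha, hu.mul_right_dvd]
  exact ⟨b, hb⟩

theorem exists_aux {F : Type} [Field F] {m n : ℕ} (hm : 1 ≤ m) (hn : 1 ≤ n) (d : ℕ) :
    ∀ f ∈ TT F d m, ∃ p ∈ PP F d n m, prodMap n p = f := by
  induction d using Nat.strong_induction_on with
  | _ d ih =>
  intro f hf
  by_cases hfree : FreeT n f
  · refine ⟨(1, f), ⟨monic_one, fun i => ⟨(hf i).1, by simpa using (hf i).2⟩, hfree⟩, ?_⟩
    funext i; simp [prodMap]
  · unfold FreeT at hfree
    push Not at hfree
    obtain ⟨g0, hg0, hu⟩ := hfree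
    have hg00 : g0 ≠ 0 := by
      rintro rfl
      have := hg0 ⟨0, hm⟩
      rw [zero_pow (by omega), zero_dvd_iff] at this
      exact (hf _).1.ne_zero this
    obtain ⟨g, hg, hgm, hgd⟩ : ∃ g : F[X], (∀ i, g ^ n ∣ f i) ∧ g.Monic ∧ 0 < g.natDegree := by
      classical
      refine ⟨normalize g0, fun i => ?_, monic_normalize hg00, ?_⟩
      · exact (pow_dvd_pow_of_dvd (normalize_associated g0).dvd n).trans (hg0 i)
      · rw [Nat.pos_iff_ne_zero]
        intro h0
        have h1 := (monic_normalize hg00).natDegree_eq_zero.1 h0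
        exact hu (normalize_eq_one.1 h1)
    choose k hk using hg
    have hkm : ∀ i, (k i).Monic := fun i => (hgm.pow n).of_mul_monic_left (hk i ▸ (hf i).1)
    have hkd : ∀ i, n * g.natDegree + (k i).natDegree = d := fun i => by
      rw [← (hf i).2, hk i, (hgm.pow n).natDegree_mul (hkm i), hgm.natDegree_pow]
    have hpos : 0 < n * g.natDegree := Nat.mul_pos hn hgd
    have h0 := hkd ⟨0, hm⟩
    obtain ⟨⟨g1, h⟩, ⟨hp1, hp2, hp3⟩, hp⟩ := ih (d - n * g.natDegree) (by omega) k
      (fun i => ⟨hkm i, by have := hkd i; omega⟩)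
    replace hp1 : g1.Monic := hp1
    refine ⟨(g * g1, h), ⟨hgm.mul hp1, fun i => ⟨(hp2 i).1, ?_⟩, hp3⟩, ?_⟩
    · have : n * g1.natDegree + (h i).natDegree = d - n * g.natDegree := (hp2 i).2
      change n * (g * g1).natDegree + (h i).natDegree = d
      rw [hgm.natDegree_mul hp1, mul_add]
      omega
    · funext i
      have := congrFun hp i
      simp only [prodMap] at this ⊢
      rw [hk i, ← this]; ring

theorem bij {F : Type} [Field F] {m n : ℕ} (hm : 1 ≤ m) (hn : 1 ≤ n) (d : ℕ) :
    Set.BijOn (prodMap n) (PP F d n m) (TT F d m) := by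
  refine ⟨?_, ?_, fun f hf => exists_aux hm hn d f hf⟩
  · rintro ⟨g, h⟩ ⟨h1, h2, h3⟩ i
    refine ⟨(h1.pow n).mul (h2 i).1, ?_⟩
    simp only [prodMap] at *
    rw [(h1.pow n).natDegree_mul (h2 i).1, h1.natDegree_pow]
    exact (h2 i).2
  · rintro ⟨g, h⟩ ⟨h1, h2, h3⟩ ⟨g', h'⟩ ⟨h1', h2', h3'⟩ e
    simp only at *
    have e' : ∀ i, g ^ n * h i = g' ^ n * h' i := fun i => congrFun e i
    have hgg : g = g' := eq_of_monic_of_associated h1 h1'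
      (associated_of_dvd_dvd (inj_aux g g' h h' h1 h1' h3' e')
        (inj_aux g' g h' h h1' h1 h3 fun i => (e' i).symm))
    subst hgg
    have : h = h' := funext fun i => mul_left_cancel₀ (h1.pow n).ne_zero (e' i)
    rw [this]

theorem bij3 {F : Type} [Field F] {m n : ℕ} (hm : 1 ≤ m) (hn : 1 ≤ n) (d : ℕ) :
    Set.BijOn (prodMap n) (PP F d n m ∩ {p | p.1 ≠ 1}) (TT F d m \ {f | FreeT n f}) := by
  refine ⟨?_, (bij hm hn d).injOn.mono Set.inter_subset_left, ?_⟩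
  · rintro ⟨g, h⟩ ⟨hp, hne⟩
    refine ⟨(bij hm hn d).mapsTo hp, fun hfree => hne ?_⟩
    exact hp.1.eq_one_of_isUnit (hfree g fun i => ⟨h i, rfl⟩)
  · rintro f ⟨hf, hnf⟩
    obtain ⟨p, hp, rfl⟩ := exists_aux hm hn d f hf
    refine ⟨p, ⟨hp, fun h1 => hnf ?_⟩, rfl⟩
    have : prodMap n p = p.2 := by funext i; simp [prodMap, h1]
    simp only [Set.mem_setOf_eq, this]
    exact hp.2.2

theorem bij2 {F : Type} [Field F] {m n : ℕ} (hm : 1 ≤ m) (d : ℕ) (hd : n ≤ d) :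
    Set.BijOn (fun cp : F × (F[X] × (Fin m → F[X])) => (X * cp.2.1 + C cp.1, cp.2.2))
      (Set.univ ×ˢ PP F (d - n) n m) (PP F d n m ∩ {p | p.1 ≠ 1}) := by
  refine ⟨?_, ?_, ?_⟩
  · rintro ⟨c, g, h⟩ ⟨-, h1, h2, h3⟩
    simp only at h1 h2 h3
    have hX : (X * g).natDegree = g.natDegree + 1 := by
      rw [monic_X.natDegree_mul h1, natDegree_X, add_comm]
    have hdeg : (X * g + C c).natDegree = g.natDegree + 1 := by
      rw [natDegree_add_C, hX]
    have hmon : (X * g + C c).Monic := by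
      apply (monic_X.mul h1).add_of_left
      refine degree_C_le.trans_lt ?_
      rw [← natDegree_pos_iff_degree_pos, hX]; omega
    refine ⟨⟨hmon, fun i => ⟨(h2 i).1, ?_⟩, h3⟩, ?_⟩
    · have := (h2 i).2
      simp only [hdeg, mul_add]
      omega
    · intro h0
      simp only at h0
      rw [h0] at hdeg
      simp at hdeg
  · rintro ⟨c, g, h⟩ - ⟨c', g', h'⟩ - e
    simp only [Prod.mk.injEq] at e ⊢
    obtain ⟨e, rfl⟩ := e
    have hc : c = c' := by simpa using congrArg (fun p => p.coeff 0) e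
    subst hc
    have := mul_left_cancel₀ X_ne_zero (add_right_cancel e)
    exact ⟨rfl, this, rfl⟩
  · rintro ⟨g, h⟩ ⟨⟨h1, h2, h3⟩, hne⟩
    simp only [Set.mem_setOf_eq] at h1 h2 h3 hne
    have hgd : g.natDegree ≠ 0 := fun h0 => hne (h1.natDegree_eq_zero.1 h0)
    have hdd : g.divX.natDegree = g.natDegree - 1 := natDegree_divX_eq_natDegree_tsub_one
    refine ⟨(g.coeff 0, g.divX, h), ⟨trivial, ?_, fun i => ⟨(h2 i).1, ?_⟩, h3⟩, ?_⟩
    · simp only [Monic, leadingCoeff, hdd, coeff_divX]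
      rw [Nat.sub_add_cancel (by omega)]
      exact h1
    · have := (h2 i).2
      simp only [hdd]
      obtain ⟨k, hk⟩ := Nat.exists_eq_succ_of_ne_zero hgd
      rw [hk, Nat.succ_eq_add_one, mul_add] at this
      rw [hk, Nat.succ_sub_one]
      omega
    · simp [X_mul_divX_add]

theorem card_TT (F : Type) [Field F] [Fintype F] (d m : ℕ) :
    Nat.card (TT F d m) = Fintype.card F ^ (d * m) ∧ Finite (TT F d m) := by
  let e : TT F d m ≃ (Fin m → Fin d → F) :=
    (Equiv.subtypePiEquivPi (p := fun _ (f : F[X]) => f.Monic ∧ f.natDegree = d)).trans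
      (Equiv.piCongrRight fun _ => (monicEquivDegreeLT d).trans (degreeLTEquiv F d).toEquiv)
  refine ⟨?_, Finite.of_equiv _ e.symm⟩
  rw [Nat.card_congr e]
  simp [pow_mul]

theorem stmt_0 (F : Type) [Field F] [Fintype F] (q d n m : ℕ)
    (hq : Fintype.card F = q) (hn : 1 ≤ n) (hd : n ≤ d) (hm : 1 ≤ m) :
    Nat.card {f : Fin m → Polynomial F //
      (∀ i, (f i).Monic ∧ (f i).natDegree = d) ∧
      ¬ ∃ α : AlgebraicClosure F, ∀ i,
        (X - C α) ^ n ∣ (f i).map (algebraMap F (AlgebraicClosure F))} =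
    q ^ (d * m) - q ^ ((d - n) * m + 1) := by
  subst hq
  have hset : {f : Fin m → Polynomial F |
      (∀ i, (f i).Monic ∧ (f i).natDegree = d) ∧
      ¬ ∃ α : AlgebraicClosure F, ∀ i,
        (X - C α) ^ n ∣ (f i).map (algebraMap F (AlgebraicClosure F))} =
      TT F d m \ (TT F d m \ {f | FreeT n f}) := by
    ext f
    simp only [Set.mem_setOf_eq, Set.mem_diff, not_and, not_not]
    constructor
    · rintro ⟨h1, h2⟩
      exact ⟨h1, fun _ => (free_iff hm f (fun i => (h1 i).1) hn).1 h2⟩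
    · rintro ⟨h1, h2⟩
      exact ⟨h1, (free_iff hm f (fun i => (h1 i).1) hn).2 (h2 h1)⟩
  change (Set.ncard {f : Fin m → Polynomial F |
      (∀ i, (f i).Monic ∧ (f i).natDegree = d) ∧
      ¬ ∃ α : AlgebraicClosure F, ∀ i,
        (X - C α) ^ n ∣ (f i).map (algebraMap F (AlgebraicClosure F))}) = _
  have hfin : (TT F d m).Finite := (card_TT F d m).2
  rw [hset, Set.ncard_diff Set.diff_subset (hfin.subset Set.diff_subset)]
  have hA : (TT F d m).ncard = Fintype.card F ^ (d * m) := (card_TT F d m).1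
  have hB : (TT F (d - n) m).ncard = Fintype.card F ^ ((d - n) * m) := (card_TT F (d - n) m).1
  have hP : (PP F (d - n) n m).ncard = (TT F (d - n) m).ncard :=
    Nat.card_congr ((bij hm hn (d - n)).equiv _)
  have hC : (TT F d m \ {f | FreeT n f}).ncard
      = ((Set.univ : Set F) ×ˢ PP F (d - n) n m).ncard :=
    (Nat.card_congr (((bij3 hm hn d).comp (bij2 hm d hd)).equiv _)).symm
  rw [hA, hC, Set.ncard_prod, hP, hB, Set.ncard_univ, Nat.card_eq_fintype_card, pow_succ']
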